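/- If the competition parameter satisfies 0 < ε < C₁(K,T,r) := (1/(K² · T · 2^{K+8})) · min{1 + K·T, √r}, then the HJB–Kolmogorov system admits at least one solution (V_1,…,V_K, m_0,…,m_K) on [0,T]. -/

import Mathlib

noncomputable section

/-- The proportion of active firms: `η(t) = ∑_{k=1}^K m_k(t)`. -/
def marketEta (K : ℕ) (m : ℕ → ℝ → ℝ) (t : ℝ) : ℝ := ∑ k ∈ Finset.Icc 1 K, m k t

/-- The interaction functional
`φ(t) = (∑_{k=1}^K m_k(t)·ΔV_k(t) − η(t)) / (2 + ε·η(t))`, where `ΔV_k = V_k − V_{k−1}`. -/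
def marketPhi (K : ℕ) (ε : ℝ) (V m : ℕ → ℝ → ℝ) (t : ℝ) : ℝ :=
  ((∑ k ∈ Finset.Icc 1 K, m k t * (V k t - V (k - 1) t)) - marketEta K m t) /
    (2 + ε * marketEta K m t)

/-- The equilibrium sale intensity `G_k(t) = ½(1 − ΔV_k(t) + ε·φ(t))`. -/
def marketLam (K : ℕ) (ε : ℝ) (V m : ℕ → ℝ → ℝ) (k : ℕ) (t : ℝ) : ℝ :=
  (1 / 2) * (1 - (V k t - V (k - 1) t) + ε * marketPhi K ε V m t)

/-- `(V, m)` is a solution of the HJB–Kolmogorov system on `[0, T]` with data `K, r, ε, M`: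
`V_1, …, V_K` and `m_0, …, m_K` are continuously differentiable on `[0, T]`, `V_0 ≡ 0`,
the HJB equations `V_k' − r V_k + ¼(1 − ΔV_k + ε φ)² = 0` hold for `k = 1, …, K`,
the Kolmogorov equations hold, `V_k(T) = 0`, and `m_k(0) = M_k`. -/
def IsHJBKolSolution (K : ℕ) (T r ε : ℝ) (M : ℕ → ℝ) (V m : ℕ → ℝ → ℝ) : Prop :=
  (∀ t : ℝ, V 0 t = 0) ∧
  (∀ k, 1 ≤ k → k ≤ K → ContDiffOn ℝ 1 (V k) (Set.Icc 0 T)) ∧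
  (∀ k, k ≤ K → ContDiffOn ℝ 1 (m k) (Set.Icc 0 T)) ∧
  (∀ k, 1 ≤ k → k ≤ K → ∀ t ∈ Set.Icc (0 : ℝ) T,
    derivWithin (V k) (Set.Icc 0 T) t - r * V k t +
      (1 / 4) * (1 - (V k t - V (k - 1) t) + ε * marketPhi K ε V m t) ^ 2 = 0) ∧
  (∀ t ∈ Set.Icc (0 : ℝ) T,
    derivWithin (m 0) (Set.Icc 0 T) t = marketLam K ε V m 1 t * m 1 t) ∧
  (∀ k, 1 ≤ k → k ≤ K - 1 → ∀ t ∈ Set.Icc (0 : ℝ) T,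
    derivWithin (m k) (Set.Icc 0 T) t =
      marketLam K ε V m (k + 1) t * m (k + 1) t - marketLam K ε V m k t * m k t) ∧
  (∀ t ∈ Set.Icc (0 : ℝ) T,
    derivWithin (m K) (Set.Icc 0 T) t = -(marketLam K ε V m K t) * m K t) ∧
  (∀ k, 1 ≤ k → k ≤ K → V k T = 0) ∧
  (∀ k, k ≤ K → m k 0 = M k)

section

open Metric MeasureTheory Set NNReal ENNReal

lemma exists_det_one_add_eq_sum (ι : Type*) [Fintype ι] [DecidableEq ι] {δ : ℝ} (hδ : 0 < δ) :
    ∃ (s : Finset ℝ) (c : ℝ → ℝ), (∀ t ∈ s, 0 < t ∧ t < δ) ∧ ∑ t ∈ s, c t = 1 ∧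
      ∀ A : Matrix ι ι ℝ, (1 + A).det = ∑ t ∈ s, c t * (1 + t • A).det := by
  obtain ⟨s, hs, hcard⟩ := (Ioo_infinite hδ).exists_subset_card_eq (Fintype.card ι + 1)
  have hinj : Set.InjOn (id : ℝ → ℝ) s := Function.injective_id.injOn
  refine ⟨s, fun t => (Lagrange.basis s id t).eval 1, fun t ht => hs ht, ?_, fun A => ?_⟩
  · rw [← Polynomial.eval_finsetSum, Lagrange.sum_basis hinj
      (Finset.card_pos.1 (by omega)), Polynomial.eval_one]
  · set p : Polynomial ℝ :=
      (((Polynomial.X : Polynomial ℝ) • A.map Polynomial.C +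
        (1 : Matrix ι ι ℝ).map Polynomial.C).det) with hp
    have heval : ∀ t : ℝ, p.eval t = (1 + t • A).det := by
      intro t
      rw [hp, ← Polynomial.coe_evalRingHom, RingHom.map_det]
      congr 1
      ext i j
      by_cases hij : i = j <;> simp [hij, add_comm, mul_comm t]
    have hdeg : p.degree < s.card := by
      refine lt_of_le_of_lt Polynomial.degree_le_natDegree ?_
      have := Polynomial.natDegree_det_X_add_C_le A (1 : Matrix ι ι ℝ)
      rw [hcard]
      exact_mod_cast Nat.lt_succ_of_le this
    have h1 := congrArg (Polynomial.eval 1) (Lagrange.eq_interpolate hinj hdeg)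
    rw [heval, one_smul, Lagrange.interpolate_apply, Polynomial.eval_finsetSum] at h1
    rw [h1]
    refine Finset.sum_congr rfl fun t _ => ?_
    simp [heval, mul_comm]

/-- The image measure of a ball under a small perturbation. -/
lemma image_closedBall_id_add_smul {E : Type*} [NormedAddCommGroup E] [NormedSpace ℝ E]
    [CompleteSpace E]
    {g : E → E} {L : ℝ≥0} (hg : LipschitzWith L g) {R : ℝ}
    (hsupp : ∀ x, R ≤ ‖x‖ → g x = 0) {t : ℝ} (ht : |t| * L < 1) :
    Function.Injective (fun x => x + t • g x) ∧
      (fun x => x + t • g x) '' closedBall 0 R = closedBall 0 R := by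
  set f : E → E := fun x => x + t • g x with hf
  rcases subsingleton_or_nontrivial E with hE | hE
  · exact ⟨Function.injective_of_subsingleton _, by
      ext x
      constructor
      · rintro ⟨y, hy, -⟩
        rwa [Subsingleton.elim x y]
      · exact fun hx => ⟨x, hx, Subsingleton.elim _ _⟩⟩
  set c : ℝ≥0 := ‖t‖₊ * L with hc
  have happ : ApproximatesLinearOn f ((ContinuousLinearEquiv.refl ℝ E : E ≃L[ℝ] E) : E →L[ℝ] E)
      univ c := by
    intro x _ y _
    have : f x - f y - ((ContinuousLinearEquiv.refl ℝ E : E ≃L[ℝ] E) : E →L[ℝ] E) (x - y)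
        = t • (g x - g y) := by
      simp [hf, smul_sub]; abel
    rw [this, norm_smul, hc, NNReal.coe_mul, mul_assoc]
    exact mul_le_mul_of_nonneg_left (by simpa [dist_eq_norm] using hg.dist_le_mul x y)
      (norm_nonneg _)
  have hc1 : c < ‖((ContinuousLinearEquiv.refl ℝ E).symm : E →L[ℝ] E)‖₊⁻¹ := by
    have : ‖((ContinuousLinearEquiv.refl ℝ E).symm : E →L[ℝ] E)‖₊ = 1 := by
      exact NNReal.eq (by simp)
    rw [this, inv_one, ← NNReal.coe_lt_coe]
    simpa [hc] using ht
  have hinj : Function.Injective f := injOn_univ.1 (happ.injOn (Or.inr hc1))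
  have hsurj : Function.Surjective f := happ.surjective (Or.inr hc1)
  have hout : ∀ x, R ≤ ‖x‖ → f x = x := fun x hx => by simp [hf, hsupp x hx]
  refine ⟨hinj, Subset.antisymm ?_ ?_⟩
  · rintro _ ⟨x, hx, rfl⟩
    by_contra hcon
    rw [mem_closedBall_zero_iff, not_le] at hcon
    have := hinj (hout _ hcon.le)
    rw [this] at hcon
    exact absurd (mem_closedBall_zero_iff.1 hx) (not_le.2 hcon)
  · intro y hy
    obtain ⟨x, rfl⟩ := hsurj y
    refine ⟨x, ?_, rfl⟩
    by_contra hcon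
    rw [mem_closedBall_zero_iff, not_le] at hcon
    rw [hout x hcon.le, mem_closedBall_zero_iff] at hy
    exact absurd hy (not_le.2 hcon)

lemma LipschitzWith.volume_image_eq_zero {ι : Type*} [Fintype ι] {f : (ι → ℝ) → (ι → ℝ)}
    {L : ℝ≥0} (hf : LipschitzWith L f) {s : Set (ι → ℝ)} (hs : volume s = 0) :
    volume (f '' s) = 0 := by
  rw [← hausdorffMeasure_pi_real] at hs ⊢
  have := hf.hausdorffMeasure_image_le (d := Fintype.card ι) (by positivity) s
  rw [hs, mul_zero] at this
  exact le_antisymm this zero_le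

lemma exists_pos_det_one_add_smul_pos (ι : Type*) [Fintype ι] (C : ℝ) :
    ∃ δ > 0, ∀ t : ℝ, |t| < δ → ∀ A : (ι → ℝ) →L[ℝ] (ι → ℝ), ‖A‖ ≤ C →
      0 < (1 + t • A : (ι → ℝ) →L[ℝ] (ι → ℝ)).det := by
  have hcont : Continuous fun A : (ι → ℝ) →L[ℝ] (ι → ℝ) => A.det :=
    ContinuousLinearMap.continuous_det
  have h1 : (0 : ℝ) < (1 : (ι → ℝ) →L[ℝ] (ι → ℝ)).det := by
    simp [ContinuousLinearMap.det]
  obtain ⟨ε, hε, h⟩ := Metric.mem_nhds_iff.1 (hcont.continuousAt.eventually (lt_mem_nhds h1))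
  refine ⟨ε / (|C| + 1), by positivity, fun t ht A hA => h ?_⟩
  rw [mem_ball, dist_eq_norm, add_sub_cancel_left, norm_smul, Real.norm_eq_abs]
  rw [lt_div_iff₀ (by positivity)] at ht
  refine lt_of_le_of_lt (mul_le_mul_of_nonneg_left (?_ : ‖A‖ ≤ |C| + 1) (abs_nonneg t)) ht
  linarith [le_abs_self C]

lemma integral_det_id_add_fderiv {ι : Type*} [Fintype ι] [DecidableEq ι]
    {g : (ι → ℝ) → (ι → ℝ)} {L : ℝ≥0} (hg : LipschitzWith L g) {R : ℝ}
    (hsupp : ∀ x, R ≤ ‖x‖ → g x = 0) :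
    ∫ x in closedBall (0 : ι → ℝ) R, (1 + fderiv ℝ g x : (ι → ℝ) →L[ℝ] (ι → ℝ)).det
      = volume.real (closedBall (0 : ι → ℝ) R) := by
  set B := closedBall (0 : ι → ℝ) R with hB
  obtain ⟨δ, hδ, hpos⟩ := exists_pos_det_one_add_smul_pos ι L
  have hfd : ∀ x, ‖fderiv ℝ g x‖ ≤ L := fun x => norm_fderiv_le_of_lipschitz ℝ hg
  have hmeas : ∀ t : ℝ, Measurable fun x =>
      (1 + t • fderiv ℝ g x : (ι → ℝ) →L[ℝ] (ι → ℝ)).det := fun t =>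
    (ContinuousLinearMap.continuous_det.measurable.comp
      ((measurable_fderiv ℝ g).const_smul t |>.const_add 1))
  have hint : ∀ t : ℝ, IntegrableOn (fun x =>
      (1 + t • fderiv ℝ g x : (ι → ℝ) →L[ℝ] (ι → ℝ)).det) B := by
    intro t
    have hbd : ∃ C, ∀ A ∈ closedBall (0 : (ι → ℝ) →L[ℝ] (ι → ℝ)) L,
        ‖(1 + t • A : (ι → ℝ) →L[ℝ] (ι → ℝ)).det‖ ≤ C := by
      refine (isCompact_closedBall _ _).exists_bound_of_continuousOn (Continuous.continuousOn ?_)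
      exact ContinuousLinearMap.continuous_det.comp (by fun_prop)
    obtain ⟨C, hC⟩ := hbd
    refine Measure.integrableOn_of_bounded (M := C)
      (isCompact_closedBall _ _).measure_lt_top.ne (hmeas t).aestronglyMeasurable ?_
    exact Filter.Eventually.of_forall fun x => hC _ (by simpa using hfd x)
  have hsmall : ∀ t : ℝ, 0 < t → t < δ → t * L < 1 →
      ∫ x in B, (1 + t • fderiv ℝ g x : (ι → ℝ) →L[ℝ] (ι → ℝ)).det = volume.real B := by
    intro t ht0 htδ htL
    obtain ⟨hinj, himg⟩ := image_closedBall_id_add_smul hg hsupp (t := t)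
      (by rwa [abs_of_pos ht0])
    set f : (ι → ℝ) → (ι → ℝ) := fun x => x + t • g x with hf
    have hflip : LipschitzWith (1 + ‖t‖₊ * L) f := by
      refine LipschitzWith.id.add (LipschitzWith.of_dist_le_mul fun x y => ?_)
      rw [dist_smul₀, NNReal.coe_mul, mul_assoc, coe_nnnorm]
      exact mul_le_mul_of_nonneg_left (hg.dist_le_mul x y) (norm_nonneg t)
    set D : Set (ι → ℝ) := {x | DifferentiableAt ℝ g x} with hD
    have hDm : MeasurableSet D := measurableSet_of_differentiableAt ℝ g
    have hDc : volume Dᶜ = 0 := hg.ae_differentiableAt (μ := volume)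
    have hder : ∀ x ∈ B ∩ D, HasFDerivWithinAt f
        (1 + t • fderiv ℝ g x : (ι → ℝ) →L[ℝ] (ι → ℝ)) (B ∩ D) x := fun x hx =>
      ((hasFDerivAt_id x).add ((hx.2.hasFDerivAt).const_smul t)).hasFDerivWithinAt
    have hcv := lintegral_abs_det_fderiv_eq_addHaar_image volume
      (isClosed_closedBall.measurableSet.inter hDm) hder hinj.injOn
    have hBD : (B ∩ D : Set (ι → ℝ)) =ᵐ[volume] B := by
      refine inter_ae_eq_left_of_ae_eq_univ ?_
      exact ae_eq_univ.2 hDc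
    have hvol : volume (f '' (B ∩ D)) = volume B := by
      refine le_antisymm
        ((measure_mono (image_mono inter_subset_left)).trans (measure_mono himg.subset)) ?_
      calc volume B = volume (f '' B) := by rw [himg]
        _ ≤ volume (f '' (B ∩ D) ∪ f '' Dᶜ) := measure_mono (by
            rw [← image_union]
            exact image_mono fun x hx => by
              by_cases h : x ∈ D
              · exact Or.inl ⟨hx, h⟩
              · exact Or.inr h)
        _ ≤ volume (f '' (B ∩ D)) + volume (f '' Dᶜ) := measure_union_le _ _
        _ = volume (f '' (B ∩ D)) := by rw [hflip.volume_image_eq_zero hDc, add_zero]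
    rw [hvol, setLIntegral_congr hBD] at hcv
    have hdpos : ∀ x, 0 < (1 + t • fderiv ℝ g x : (ι → ℝ) →L[ℝ] (ι → ℝ)).det := fun x =>
      hpos t (by rwa [abs_of_pos ht0]) _ (hfd x)
    rw [integral_eq_lintegral_of_nonneg_ae (Filter.Eventually.of_forall fun x => (hdpos x).le)
      (hmeas t).aestronglyMeasurable, Measure.real, ← hcv]
    simp_rw [abs_of_pos (hdpos _)]
  obtain ⟨s, c, hs, hc, hdet⟩ := exists_det_one_add_eq_sum ι
    (lt_min hδ (show (0 : ℝ) < 1 / (L + 1) by positivity))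
  have hdet' : ∀ A : (ι → ℝ) →L[ℝ] (ι → ℝ), (1 + A : (ι → ℝ) →L[ℝ] (ι → ℝ)).det =
      ∑ t ∈ s, c t * (1 + t • A : (ι → ℝ) →L[ℝ] (ι → ℝ)).det := by
    intro A
    have key : ∀ B : (ι → ℝ) →L[ℝ] (ι → ℝ), (1 + B : (ι → ℝ) →L[ℝ] (ι → ℝ)).det =
        (1 + LinearMap.toMatrix' (B : (ι → ℝ) →ₗ[ℝ] (ι → ℝ))).det := by
      intro B
      rw [ContinuousLinearMap.det, ← LinearMap.det_toMatrix']
      congr 1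
      rw [ContinuousLinearMap.toLinearMap_add, map_add]
      congr 1
      exact LinearMap.toMatrix'_one
    rw [key, hdet]
    refine Finset.sum_congr rfl fun t _ => ?_
    rw [key, ContinuousLinearMap.toLinearMap_smul, map_smul]
  rw [integral_congr_ae (Filter.Eventually.of_forall fun x => hdet' (fderiv ℝ g x))]
  rw [integral_finsetSum _ fun t _ => (hint t).const_mul (c t)]
  simp_rw [integral_const_mul]
  have hterm : ∀ t ∈ s, c t * ∫ x in B, (1 + t • fderiv ℝ g x : (ι → ℝ) →L[ℝ] (ι → ℝ)).det
      = c t * volume.real B := by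
    intro t ht
    have h2 := (hs t ht).2.trans_le (min_le_right _ _)
    rw [lt_div_iff₀ (by positivity)] at h2
    rw [hsmall t (hs t ht).1 ((hs t ht).2.trans_le (min_le_left _ _))
      (by nlinarith [(hs t ht).1])]
  rw [Finset.sum_congr rfl hterm, ← Finset.sum_mul, hc, one_mul]

lemma lipschitzWith_inv_max_norm_smul {E : Type*} [NormedAddCommGroup E] [NormedSpace ℝ E]
    {c : ℝ≥0} (hc : 0 < c) : LipschitzWith (2 / c) fun x : E => (max (c : ℝ) ‖x‖)⁻¹ • x := by
  refine LipschitzWith.of_dist_le_mul fun x y => ?_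
  have hc' : (0 : ℝ) < c := hc
  set p := max (c : ℝ) ‖x‖ with hp
  set q := max (c : ℝ) ‖y‖ with hq
  have hp0 : 0 < p := lt_max_of_lt_left hc'
  have hq0 : 0 < q := lt_max_of_lt_left hc'
  have hpq : |q - p| ≤ ‖x - y‖ := by
    rw [abs_sub_comm]
    refine (abs_max_sub_max_le_max _ _ _ _).trans ?_
    simpa using abs_norm_sub_norm_le x y
  have heq : p⁻¹ • x - q⁻¹ • y = p⁻¹ • (x - y) + ((q - p) / (p * q)) • y := by
    have : (q - p) / (p * q) = p⁻¹ - q⁻¹ := by field_simp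
    rw [this, smul_sub, sub_smul]; abel
  have hyq : ‖y‖ / q ≤ 1 := (div_le_one hq0).2 (le_max_right _ _)
  have h1 : ‖p⁻¹ • (x - y)‖ ≤ ‖x - y‖ / c := by
    rw [norm_smul, Real.norm_of_nonneg (inv_nonneg.2 hp0.le), inv_mul_eq_div]
    exact div_le_div_of_nonneg_left (norm_nonneg _) hc' (le_max_left _ _)
  have h2 : ‖((q - p) / (p * q)) • y‖ ≤ ‖x - y‖ / c := by
    rw [norm_smul, Real.norm_eq_abs, abs_div, abs_of_pos (mul_pos hp0 hq0)]
    calc |q - p| / (p * q) * ‖y‖ = |q - p| / p * (‖y‖ / q) := by field_simp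
      _ ≤ |q - p| / p * 1 := mul_le_mul_of_nonneg_left hyq (by positivity)
      _ ≤ ‖x - y‖ / c := by
        rw [mul_one]
        exact div_le_div₀ (norm_nonneg _) hpq hc' (le_max_left _ _)
  rw [dist_eq_norm, dist_eq_norm, heq]
  refine (norm_add_le _ _).trans ((add_le_add h1 h2).trans (le_of_eq ?_))
  push_cast
  ring

lemma LipschitzWith.smul_of_bounded {X E : Type*} [PseudoMetricSpace X] [NormedAddCommGroup E]
    [NormedSpace ℝ E] {a : X → ℝ} {f : X → E} {A F : ℝ≥0} (ha : LipschitzWith A a)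
    (hf : LipschitzWith F f) {α φ : ℝ≥0} (hα : ∀ x, ‖a x‖ ≤ α) (hφ : ∀ x, ‖f x‖ ≤ φ) :
    LipschitzWith (α * F + A * φ) fun x => a x • f x := by
  refine LipschitzWith.of_dist_le_mul fun x y => ?_
  have h : a x • f x - a y • f y = a x • (f x - f y) + (a x - a y) • f y := by
    rw [smul_sub, sub_smul]; abel
  rw [dist_eq_norm, h]
  refine (norm_add_le _ _).trans ?_
  rw [norm_smul, norm_smul]
  have h1 : ‖a x‖ * ‖f x - f y‖ ≤ α * (F * dist x y) :=
    mul_le_mul (hα x) (by simpa [dist_eq_norm] using hf.dist_le_mul x y) (norm_nonneg _) α.2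
  have h2 : ‖a x - a y‖ * ‖f y‖ ≤ (A * dist x y) * φ :=
    mul_le_mul (by simpa [dist_eq_norm] using ha.dist_le_mul x y) (hφ y) (norm_nonneg _)
      (by positivity)
  push_cast
  linarith

/-- There is no invertible derivative at a point around which the norm is constant. -/
lemma HasFDerivAt.det_eq_zero_of_norm_eventuallyEq {ι : Type*} [Fintype ι] [DecidableEq ι]
    {f : (ι → ℝ) → (ι → ℝ)} {f' : (ι → ℝ) →L[ℝ] (ι → ℝ)} {x : ι → ℝ} {R : ℝ} (hR : 0 < R)
    (hf : HasFDerivAt f f' x) (h : ∀ᶠ y in nhds x, ‖f y‖ = R) : f'.det = 0 := by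
  by_contra hdet
  have hsurj : Function.Surjective f' :=
    (LinearMap.equivOfDetNeZero (f' : (ι → ℝ) →ₗ[ℝ] (ι → ℝ)) hdet).surjective
  obtain ⟨v, hv⟩ := hsurj (f x)
  have hline : HasDerivAt (fun t : ℝ => f (x + t • v)) (f x) 0 := by
    have h1 : HasDerivAt (fun t : ℝ => x + t • v) v 0 := by
      simpa using ((hasDerivAt_id (0 : ℝ)).smul_const v).const_add x
    have h2 : HasFDerivAt f f' (x + (0 : ℝ) • v) := by simpa using hf
    have h3 := h2.comp_hasDerivAt (0 : ℝ) h1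
    rwa [hv] at h3
  have hcont : Filter.Tendsto (fun t : ℝ => x + t • v) (nhds 0) (nhds x) := by
    have : Continuous fun t : ℝ => x + t • v := by fun_prop
    simpa using this.tendsto 0
  have hlit := hline.isLittleO
  have hsm := (hlit.def (show (0 : ℝ) < R / 2 by positivity)).and (hcont.eventually h)
  obtain ⟨d, hd, hball⟩ := Metric.eventually_nhds_iff.1 hsm
  obtain ⟨h1, h2⟩ := hball (show dist (d / 2) 0 < d by
    rw [Real.dist_0_eq_abs, _root_.abs_of_pos (by positivity)]; linarith)
  have h0 : ‖f x‖ = R := h.self_of_nhds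
  simp only [sub_zero, zero_smul, add_zero] at h1
  have h3 : ‖(1 + d / 2) • f x‖ = (1 + d / 2) * R := by
    rw [norm_smul, h0, Real.norm_of_nonneg (by positivity)]
  have h4 : (1 + d / 2) • f x =
      f (x + (d / 2) • v) - (f (x + (d / 2) • v) - f x - (d / 2) • f x) := by
    rw [add_smul, one_smul]; abel
  have h5 := norm_sub_le (f (x + (d / 2) • v))
    (f (x + (d / 2) • v) - f x - (d / 2) • f x)
  rw [← h4, h3, h2] at h5
  rw [Real.norm_of_nonneg (by positivity : (0 : ℝ) ≤ d / 2)] at h1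
  nlinarith [mul_pos hd hR]

/-- There is no Lipschitz map of the space into a sphere fixing the sphere pointwise. -/
lemma not_lipschitzWith_retraction_sphere {ι : Type*} [Fintype ι] {h : (ι → ℝ) → (ι → ℝ)}
    {L : ℝ≥0} (hL : LipschitzWith L h) {R : ℝ} (hR : 0 < R) (hnorm : ∀ x, ‖h x‖ = R)
    (hfix : ∀ x, ‖x‖ = R → h x = x) : False := by
  classical
  lift R to ℝ≥0 using hR.le
  have hR' : 0 < R := hR
  set N : (ι → ℝ) → (ι → ℝ) := fun x => (R : ℝ) • ((max (R : ℝ) ‖x‖)⁻¹ • x) with hN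
  have hNin : ∀ x, ‖x‖ ≤ R → N x = x := fun x hx => by
    simp [hN, max_eq_left hx, smul_smul, hR.ne']
  have hNout : ∀ x, (R : ℝ) ≤ ‖x‖ → ‖N x‖ = R := fun x hx => by
    have : ‖x‖ ≠ 0 := (hR.trans_le hx).ne'
    simp [hN, max_eq_right hx, norm_smul, this]
  have hNL : ∃ C, LipschitzWith C N :=
    ⟨_, (lipschitzWith_smul (R : ℝ)).comp (lipschitzWith_inv_max_norm_smul hR')⟩
  obtain ⟨C, hC⟩ := hNL
  set g : (ι → ℝ) → (ι → ℝ) := fun x => h (N x) - N x with hg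
  have hgL : LipschitzWith (L * C + C) g := (hL.comp hC).sub hC
  have hint := integral_det_id_add_fderiv hgL (R := R) fun x hx => by
    simp [hg, hfix _ (hNout x hx)]
  have hball : ∫ x in ball (0 : ι → ℝ) R,
      (1 + fderiv ℝ g x : (ι → ℝ) →L[ℝ] (ι → ℝ)).det = 0 := by
    rw [← integral_zero (ι → ℝ) ℝ (μ := volume.restrict (ball (0 : ι → ℝ) R))]
    refine setIntegral_congr_ae isOpen_ball.measurableSet ?_
    filter_upwards [hgL.ae_differentiableAt (μ := volume)] with x hx hxb
    refine HasFDerivAt.det_eq_zero_of_norm_eventuallyEq hR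
      ((hasFDerivAt_id x).add hx.hasFDerivAt) ?_
    filter_upwards [isOpen_ball.mem_nhds hxb] with y hy
    rw [mem_ball_zero_iff] at hy
    simp [hg, hNin y hy.le, hnorm]
  have hae : (closedBall (0 : ι → ℝ) R) =ᵐ[volume] ball (0 : ι → ℝ) R := by
    rw [← ball_union_sphere]
    exact union_ae_eq_left_of_ae_eq_empty (ae_eq_empty.2
      (Measure.addHaar_sphere_of_ne_zero _ _ hR.ne'))
  rw [setIntegral_congr_set hae, hball] at hint
  have hpos : 0 < volume.real (closedBall (0 : ι → ℝ) R) :=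
    ENNReal.toReal_pos (measure_closedBall_pos volume _ hR).ne'
      (isCompact_closedBall _ _).measure_lt_top.ne
  exact hpos.ne hint

/-- **Brouwer's fixed point theorem** for bounded Lipschitz maps. -/
lemma LipschitzWith.exists_fixedPoint_of_bounded {ι : Type*} [Fintype ι]
    {Φ : (ι → ℝ) → (ι → ℝ)} {L ρ : ℝ≥0} (hΦ : LipschitzWith L Φ) (hρ : ∀ x, ‖Φ x‖ ≤ ρ) :
    ∃ x, Φ x = x := by
  by_contra! hne
  set R : ℝ≥0 := ρ + 1 with hR
  have hR0 : (0 : ℝ) < R := by positivity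
  set θ : (ι → ℝ) → ℝ := fun x => max 0 (min 1 (R - ‖x‖)) with hθ
  have hθL : LipschitzWith 1 θ := by
    have h1 : LipschitzWith 1 fun x : ι → ℝ => (R : ℝ) - ‖x‖ := by
      refine LipschitzWith.of_dist_le_mul fun x y => ?_
      rw [Real.dist_eq, NNReal.coe_one, one_mul, dist_eq_norm, abs_sub_comm,
        show (R : ℝ) - ‖y‖ - (R - ‖x‖) = ‖x‖ - ‖y‖ by ring]
      exact abs_norm_sub_norm_le x y
    exact (h1.const_min 1).const_max 0
  have hθ1 : ∀ x, ‖θ x‖ ≤ (1 : ℝ≥0) := fun x => by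
    rw [Real.norm_of_nonneg (le_max_left _ _)]
    exact max_le zero_le_one (min_le_left _ _)
  set F : (ι → ℝ) → (ι → ℝ) := fun x => x - θ x • Φ x with hF
  have hFL : LipschitzWith (1 + (1 * L + 1 * ρ)) F :=
    LipschitzWith.id.sub (hθL.smul_of_bounded hΦ hθ1 hρ)
  have hFout : ∀ x, (R : ℝ) ≤ ‖x‖ → F x = x := fun x hx => by
    have : θ x = 0 := max_eq_left ((min_le_right _ _).trans (by linarith))
    simp [hF, this]
  have hF0 : ∀ x, F x ≠ 0 := by
    intro x hx
    have hx' : x = θ x • Φ x := sub_eq_zero.1 hx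
    have hxρ : ‖x‖ ≤ ρ := by
      rw [hx', norm_smul]
      calc ‖θ x‖ * ‖Φ x‖ ≤ 1 * ρ := mul_le_mul (hθ1 x) (hρ x) (norm_nonneg _) zero_le_one
        _ = ρ := one_mul _
    have : θ x = 1 := by
      rw [hθ]
      simp only
      rw [min_eq_left, max_eq_right zero_le_one]
      rw [hR]; push_cast; linarith
    rw [this, one_smul] at hx'
    exact hne x hx'.symm
  obtain ⟨x₀, hx₀, hmin⟩ := (isCompact_closedBall (0 : ι → ℝ) R).exists_isMinOn
    ⟨0, mem_closedBall_self R.2⟩ hFL.continuous.norm.continuousOn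
  have hx₀R : ‖x₀‖ ≤ R := mem_closedBall_zero_iff.1 hx₀
  set c : ℝ≥0 := min ‖F x₀‖₊ R with hc
  have hc0 : 0 < c := lt_min (nnnorm_pos.2 (hF0 x₀)) hR0
  have hcF : ∀ x, (c : ℝ) ≤ ‖F x‖ := by
    intro x
    rcases le_total ‖x‖ R with hx | hx
    · exact (NNReal.coe_le_coe.2 (min_le_left _ _)).trans (hmin (mem_closedBall_zero_iff.2 hx))
    · rw [hFout x hx]
      exact (NNReal.coe_le_coe.2 (min_le_right _ _)).trans hx
  have hhL := (lipschitzWith_smul (β := ι → ℝ) (R : ℝ)).comp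
    ((lipschitzWith_inv_max_norm_smul (E := ι → ℝ) hc0).comp hFL)
  refine not_lipschitzWith_retraction_sphere hhL hR0 (fun x => ?_) (fun x hx => ?_)
  · have : ‖F x‖ ≠ 0 := norm_ne_zero_iff.2 (hF0 x)
    simp [max_eq_right (hcF x), norm_smul, this]
  · have h1 := hFout x hx.ge
    have h2 := hcF x
    rw [h1, hx] at h2
    simp [h1, hx, max_eq_right h2, smul_smul, hR0.ne']

/-- Boundary value problem for a bounded Lipschitz vector field: the first component is prescribed
to vanish at the final time, the second one is prescribed at the initial time. -/
lemma exists_boundary_value_solution {ι Y : Type*} [Fintype ι] [NormedAddCommGroup Y]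
    [NormedSpace ℝ Y] [CompleteSpace Y] {f : ℝ → (ι → ℝ) × Y → (ι → ℝ) × Y} {T : ℝ} (hT : 0 < T)
    {C L : ℝ≥0} (hlip : ∀ t ∈ Icc 0 T, LipschitzWith C (f t))
    (hcont : ∀ x, ContinuousOn (f · x) (Icc 0 T)) (hbd : ∀ t ∈ Icc 0 T, ∀ x, ‖f t x‖ ≤ L) (b : Y) :
    ∃ α : ℝ → (ι → ℝ) × Y,
      (∀ t ∈ Icc 0 T, HasDerivWithinAt α (f t (α t)) (Icc 0 T) t) ∧
        (α T).1 = 0 ∧ (α 0).2 = b := by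
  lift T to ℝ≥0 using hT.le
  have hT' : 0 < T := hT
  set ρ : ℝ≥0 := (L + 1) * T with hρ
  have hρ0 : 0 < ρ := by positivity
  have h0 : (0 : ℝ) ∈ Icc (0 : ℝ) T := ⟨le_rfl, hT.le⟩
  have hTm : (T : ℝ) ∈ Icc (0 : ℝ) T := ⟨hT.le, le_rfl⟩
  have hPL : IsPicardLindelof f ⟨0, h0⟩ ((0 : ι → ℝ), b) (ρ + L * T) ρ L C :=
    ⟨fun t ht => (hlip t ht).lipschitzOnWith, fun x _ => hcont x, fun t ht x _ => hbd t ht x, by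
      simp⟩
  obtain ⟨α, hα, L', hL'⟩ := hPL.exists_forall_mem_closedBall_eq_hasDerivWithinAt_lipschitzOnWith
  set N : (ι → ℝ) → (ι → ℝ) := fun x => (ρ : ℝ) • ((max (ρ : ℝ) ‖x‖)⁻¹ • x) with hN
  have hNL : LipschitzWith (‖(ρ : ℝ)‖₊ * (2 / ρ)) N :=
    (lipschitzWith_smul (ρ : ℝ)).comp (lipschitzWith_inv_max_norm_smul hρ0)
  have hNin : ∀ x, ‖x‖ ≤ ρ → N x = x := fun x hx => by
    simp [hN, max_eq_left hx, smul_smul, hρ0.ne']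
  have hmem : ∀ x, (N x, b) ∈ closedBall ((0 : ι → ℝ), b) ρ := fun x => by
    rw [mem_closedBall, Prod.dist_eq, dist_self, max_eq_left dist_nonneg, dist_zero_right]
    have hm : (0 : ℝ) < max (ρ : ℝ) ‖x‖ := lt_max_of_lt_left hρ0
    rw [hN]
    simp only [norm_smul, norm_inv, Real.norm_of_nonneg hm.le]
    rw [inv_mul_eq_div, Real.norm_of_nonneg (NNReal.coe_nonneg ρ)]
    exact mul_le_of_le_one_right ρ.2 ((div_le_one hm).2 (le_max_right _ _))
  have hmove : ∀ x, ‖N x - (α (N x, b) T).1‖ ≤ ρ := by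
    intro x
    obtain ⟨h1, h2⟩ := hα _ (hmem x)
    have h3 := (convex_Icc (0 : ℝ) T).norm_image_sub_le_of_norm_hasDerivWithin_le h2
      (fun t ht => hbd t ht _) h0 hTm
    simp only at h1
    rw [h1] at h3
    have h4 := (norm_fst_le (α (N x, b) T - (N x, b))).trans h3
    rw [Prod.fst_sub, norm_sub_rev] at h4
    refine h4.trans ?_
    rw [hρ, sub_zero, Real.norm_of_nonneg hT.le]
    push_cast
    nlinarith
  have hpair : LipschitzWith (‖(ρ : ℝ)‖₊ * (2 / ρ)) fun x => (N x, b) := by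
    refine LipschitzWith.of_dist_le_mul fun x y => ?_
    rw [Prod.dist_eq, dist_self, max_eq_left dist_nonneg]
    exact hNL.dist_le_mul x y
  have hflow : LipschitzWith (L' * (‖(ρ : ℝ)‖₊ * (2 / ρ))) fun x => α (N x, b) T :=
    lipschitzOnWith_univ.1 ((hL' T hTm).comp hpair.lipschitzOnWith fun x _ => hmem x)
  obtain ⟨x, hx⟩ := (hNL.sub (LipschitzWith.prod_fst.comp hflow)).exists_fixedPoint_of_bounded hmove
  have hxρ : ‖x‖ ≤ ρ := by
    rw [← hx]
    exact hmove x
  simp only [Function.comp_apply] at hx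
  obtain ⟨h1, h2⟩ := hα _ (hmem x)
  refine ⟨α (N x, b), h2, ?_, ?_⟩
  · rw [hNin x hxρ] at hx ⊢
    exact sub_eq_self.1 hx
  · rw [h1]

/-- Bounded Lipschitz real functions on a metric space. -/
def IsBoundedLipschitz {X : Type*} [PseudoMetricSpace X] (f : X → ℝ) : Prop :=
  ∃ C : ℝ, 0 ≤ C ∧ (∀ x, |f x| ≤ C) ∧ ∀ x y, |f x - f y| ≤ C * dist x y

namespace IsBoundedLipschitz

variable {X : Type*} [PseudoMetricSpace X] {f g : X → ℝ}

lemma const (c : ℝ) : IsBoundedLipschitz fun _ : X => c :=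
  ⟨|c|, abs_nonneg c, fun _ => le_rfl, fun x y => by simpa using by positivity⟩

lemma mul (hf : IsBoundedLipschitz f) (hg : IsBoundedLipschitz g) :
    IsBoundedLipschitz fun x => f x * g x := by
  obtain ⟨A, hA, hfA, hfL⟩ := hf
  obtain ⟨B, hB, hgB, hgL⟩ := hg
  refine ⟨A * B + A * B, by positivity, fun x => ?_, fun x y => ?_⟩
  · rw [abs_mul]
    have := mul_le_mul (hfA x) (hgB x) (abs_nonneg _) hA
    nlinarith [mul_nonneg hA hB]
  · have h1 : f x * g x - f y * g y = f x * (g x - g y) + (f x - f y) * g y := by ring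
    rw [h1]
    refine (abs_add_le _ _).trans ?_
    rw [abs_mul, abs_mul]
    have h2 := mul_le_mul (hfA x) (hgL x y) (abs_nonneg _) hA
    have h3 := mul_le_mul (hfL x y) (hgB y) (abs_nonneg _) (mul_nonneg hA dist_nonneg)
    linarith

lemma add (hf : IsBoundedLipschitz f) (hg : IsBoundedLipschitz g) :
    IsBoundedLipschitz fun x => f x + g x := by
  obtain ⟨A, hA, hfA, hfL⟩ := hf
  obtain ⟨B, hB, hgB, hgL⟩ := hg
  refine ⟨A + B, by positivity, fun x => ?_, fun x y => ?_⟩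
  · exact (abs_add_le _ _).trans (add_le_add (hfA x) (hgB x))
  · rw [add_sub_add_comm, add_mul]
    exact (abs_add_le _ _).trans (add_le_add (hfL x y) (hgL x y))

lemma sub (hf : IsBoundedLipschitz f) (hg : IsBoundedLipschitz g) :
    IsBoundedLipschitz fun x => f x - g x := by
  simpa [sub_eq_add_neg] using hf.add ((const (-1)).mul hg)

lemma sum {κ : Type*} {s : Finset κ} {F : κ → X → ℝ} (h : ∀ k, IsBoundedLipschitz (F k)) :
    IsBoundedLipschitz fun x => ∑ k ∈ s, F k x := by
  classical
  induction s using Finset.induction_on with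
  | empty => simpa using const 0
  | insert a s ha ih => simpa [Finset.sum_insert ha] using (h a).add ih

lemma max_const (hf : IsBoundedLipschitz f) : IsBoundedLipschitz fun x => max (f x) 0 := by
  obtain ⟨A, hA, hfA, hfL⟩ := hf
  refine ⟨A, hA, fun x => ?_, fun x y => ?_⟩
  · rw [abs_of_nonneg (le_max_right _ _)]
    exact max_le ((le_abs_self _).trans (hfA x)) hA
  · exact (abs_max_sub_max_le_abs _ _ _).trans (hfL x y)

lemma inv {c : ℝ} (hc : 0 < c) (hf : IsBoundedLipschitz f) (h : ∀ x, c ≤ f x) :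
    IsBoundedLipschitz fun x => (f x)⁻¹ := by
  obtain ⟨A, hA, hfA, hfL⟩ := hf
  have hpos : ∀ x, 0 < f x := fun x => hc.trans_le (h x)
  have hinv : ∀ x, (f x)⁻¹ ≤ c⁻¹ := fun x => inv_anti₀ hc (h x)
  refine ⟨c⁻¹ + A * c⁻¹ * c⁻¹, by positivity, fun x => ?_, fun x y => ?_⟩
  · rw [abs_of_pos (inv_pos.2 (hpos x))]
    exact (hinv x).trans (le_add_of_nonneg_right (by positivity))
  · have h1 : (f x)⁻¹ - (f y)⁻¹ = (f y - f x) * ((f x)⁻¹ * (f y)⁻¹) := by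
      have := (hpos x).ne'
      have := (hpos y).ne'
      field_simp
    rw [h1, abs_mul, abs_sub_comm, abs_of_pos (mul_pos (inv_pos.2 (hpos x)) (inv_pos.2 (hpos y)))]
    calc |f x - f y| * ((f x)⁻¹ * (f y)⁻¹) ≤ (A * dist x y) * (c⁻¹ * c⁻¹) :=
          mul_le_mul (hfL x y) (mul_le_mul (hinv x) (hinv y) (inv_pos.2 (hpos y)).le
            (inv_pos.2 hc).le) (mul_pos (inv_pos.2 (hpos x)) (inv_pos.2 (hpos y))).le
            (mul_nonneg hA dist_nonneg)
      _ = A * c⁻¹ * c⁻¹ * dist x y := by ring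
      _ ≤ _ := by
        rw [add_mul]
        exact le_add_of_nonneg_left (mul_nonneg (inv_pos.2 hc).le dist_nonneg)

end IsBoundedLipschitz

/-- Truncation of a real number to `[0, 1]`. -/
def clip (y : ℝ) : ℝ := max 0 (min 1 y)

lemma clip_nonneg (y : ℝ) : 0 ≤ clip y := le_max_left _ _

lemma clip_le_one (y : ℝ) : clip y ≤ 1 := max_le zero_le_one (min_le_left _ _)

lemma clip_of_nonpos {y : ℝ} (hy : y ≤ 0) : clip y = 0 := max_eq_left ((min_le_right _ _).trans hy)

lemma clip_of_mem {y : ℝ} (h0 : 0 ≤ y) (h1 : y ≤ 1) : clip y = y := by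
  rw [clip, min_eq_right h1, max_eq_right h0]

lemma clip_mono {y z : ℝ} (h : y ≤ z) : clip y ≤ clip z :=
  max_le_max le_rfl (min_le_min le_rfl h)

lemma isBoundedLipschitz_clip {X : Type*} [PseudoMetricSpace X] {f : X → ℝ} {C : ℝ}
    (h : ∀ x y, |f x - f y| ≤ C * dist x y) : IsBoundedLipschitz fun x => clip (f x) := by
  refine ⟨|C| + 1, by positivity, fun x => ?_, fun x y => ?_⟩
  · rw [abs_of_nonneg (clip_nonneg _)]
    linarith [clip_le_one (f x), abs_nonneg C]
  · have h1 : |clip (f x) - clip (f y)| ≤ |f x - f y| := by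
      refine (abs_max_sub_max_le_max _ _ _ _).trans ?_
      refine max_le (by simp) ((abs_min_sub_min_le_max _ _ _ _).trans (by simp))
    refine h1.trans ((h x y).trans (mul_le_mul_of_nonneg_right ?_ dist_nonneg))
    linarith [le_abs_self C]

lemma nonneg_of_deriv_nonpos_of_neg {f f' : ℝ → ℝ} {a b : ℝ}
    (hf : ∀ t ∈ Icc a b, HasDerivWithinAt f (f' t) (Icc a b) t) (hb : 0 ≤ f b)
    (h : ∀ t ∈ Icc a b, f t < 0 → f' t ≤ 0) : ∀ t ∈ Icc a b, 0 ≤ f t := by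
  intro t₀ ht₀
  by_contra! hneg
  have hcont : ContinuousOn f (Icc t₀ b) := fun t ht =>
    ((hf t ⟨ht₀.1.trans ht.1, ht.2⟩).continuousWithinAt).mono (Icc_subset_Icc_left ht₀.1)
  have hcomp : IsCompact (Icc t₀ b ∩ f ⁻¹' Ici 0) :=
    isCompact_Icc.of_isClosed_subset (hcont.preimage_isClosed_of_isClosed isClosed_Icc isClosed_Ici)
      inter_subset_left
  obtain ⟨s, ⟨hs, hfs⟩, hleast⟩ := hcomp.exists_isLeast ⟨b, ⟨ht₀.2, le_rfl⟩, hb⟩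
  have hbefore : ∀ t ∈ Ioo t₀ s, f t < 0 := by
    intro t ht
    by_contra! hcon
    exact absurd (hleast ⟨⟨ht.1.le, ht.2.le.trans hs.2⟩, hcon⟩) (not_le.2 ht.2)
  have hder : ∀ t ∈ Ioo t₀ s, HasDerivAt f (f' t) t := fun t ht =>
    (hf t ⟨ht₀.1.trans ht.1.le, ht.2.le.trans hs.2⟩).hasDerivAt
      (Icc_mem_nhds (ht₀.1.trans_lt ht.1) (ht.2.trans_le hs.2))
  have hanti : AntitoneOn f (Icc t₀ s) := by
    refine antitoneOn_of_deriv_nonpos (convex_Icc _ _) (hcont.mono (Icc_subset_Icc_right hs.2))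
      ?_ ?_
    · rw [interior_Icc]
      exact fun t ht => (hder t ht).differentiableAt.differentiableWithinAt
    · rw [interior_Icc]
      intro t ht
      rw [(hder t ht).deriv]
      exact h t ⟨ht₀.1.trans ht.1.le, ht.2.le.trans hs.2⟩ (hbefore t ht)
  have h1 := hanti ⟨le_rfl, hs.1⟩ ⟨hs.1, le_rfl⟩ hs.1
  have h2 : 0 ≤ f s := hfs
  linarith

lemma nonneg_of_deriv_nonneg_of_neg {f f' : ℝ → ℝ} {T : ℝ}
    (hf : ∀ t ∈ Icc 0 T, HasDerivWithinAt f (f' t) (Icc 0 T) t) (h0 : 0 ≤ f 0)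
    (h : ∀ t ∈ Icc 0 T, f t < 0 → 0 ≤ f' t) : ∀ t ∈ Icc 0 T, 0 ≤ f t := by
  have hmaps : MapsTo (fun t => T - t) (Icc 0 T) (Icc 0 T) := fun t ht =>
    ⟨sub_nonneg.2 ht.2, sub_le_self _ ht.1⟩
  have key := nonneg_of_deriv_nonpos_of_neg (f := fun t => f (T - t)) (f' := fun t => -f' (T - t))
    (a := 0) (b := T)
    (fun t ht => by
      have h1 : HasDerivWithinAt (fun t => T - t) (-1) (Icc 0 T) t :=
        ((hasDerivAt_id t).const_sub T).hasDerivWithinAt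
      have h2 := (hf (T - t) (hmaps ht)).comp t h1 hmaps
      simpa [Function.comp_def] using h2)
    (by simpa using h0) (fun t ht hlt => neg_nonpos.2 (h _ (hmaps ht) hlt))
  intro t ht
  simpa using key (T - t) (hmaps ht)

/-- The price level `1 + ε φ` computed from truncated data. -/
def truncPrice (K : ℕ) (ε : ℝ) (V m : ℕ → ℝ) : ℝ :=
  (2 + ε * ∑ k ∈ Finset.Icc 1 K, clip (m k) * clip (V k - V (k - 1))) *
    (2 + ε * ∑ k ∈ Finset.Icc 1 K, clip (m k))⁻¹

/-- Twice the sale intensity, computed from truncated data and extended by zero. -/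
def truncRate (K : ℕ) (ε : ℝ) (V m : ℕ → ℝ) (k : ℕ) : ℝ :=
  if 1 ≤ k ∧ k ≤ K then max (truncPrice K ε V m - clip (V k - V (k - 1))) 0 else 0

section Truncated

variable {K : ℕ} {ε : ℝ} {V m : ℕ → ℝ}

lemma truncPrice_le_one (hε : 0 ≤ ε) : truncPrice K ε V m ≤ 1 := by
  have h0 : 0 ≤ ∑ k ∈ Finset.Icc 1 K, clip (m k) := Finset.sum_nonneg fun k _ => clip_nonneg _
  have h1 : ∑ k ∈ Finset.Icc 1 K, clip (m k) * clip (V k - V (k - 1))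
      ≤ ∑ k ∈ Finset.Icc 1 K, clip (m k) :=
    Finset.sum_le_sum fun k _ => mul_le_of_le_one_right (clip_nonneg _) (clip_le_one _)
  rw [truncPrice, ← div_eq_mul_inv, div_le_one (by positivity)]
  have := mul_le_mul_of_nonneg_left h1 hε
  linarith

lemma le_truncPrice (hε : 0 ≤ ε) (h : ∑ k ∈ Finset.Icc 1 K, clip (m k) ≤ 1) :
    2 / (2 + ε) ≤ truncPrice K ε V m := by
  have h0 : 0 ≤ ∑ k ∈ Finset.Icc 1 K, clip (m k) := Finset.sum_nonneg fun k _ => clip_nonneg _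
  have h1 : 0 ≤ ∑ k ∈ Finset.Icc 1 K, clip (m k) * clip (V k - V (k - 1)) :=
    Finset.sum_nonneg fun k _ => mul_nonneg (clip_nonneg _) (clip_nonneg _)
  rw [truncPrice, ← div_eq_mul_inv]
  exact div_le_div₀ (by positivity) (le_add_of_nonneg_right (by positivity)) (by positivity)
    (by linarith [mul_le_mul_of_nonneg_left h hε])

lemma truncPrice_nonneg (hε : 0 ≤ ε) : 0 ≤ truncPrice K ε V m := by
  have h0 : 0 ≤ ∑ k ∈ Finset.Icc 1 K, clip (m k) := Finset.sum_nonneg fun k _ => clip_nonneg _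
  have h1 : 0 ≤ ∑ k ∈ Finset.Icc 1 K, clip (m k) * clip (V k - V (k - 1)) :=
    Finset.sum_nonneg fun k _ => mul_nonneg (clip_nonneg _) (clip_nonneg _)
  rw [truncPrice]
  positivity

lemma truncRate_nonneg (k : ℕ) : 0 ≤ truncRate K ε V m k := by
  rw [truncRate]
  split_ifs
  · exact le_max_right _ _
  · exact le_rfl

lemma truncRate_le_truncPrice (hε : 0 ≤ ε) (k : ℕ) :
    truncRate K ε V m k ≤ truncPrice K ε V m := by
  rw [truncRate]
  split_ifs
  · exact max_le (sub_le_self _ (clip_nonneg _)) (truncPrice_nonneg hε)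
  · exact truncPrice_nonneg hε

@[simp]
lemma truncRate_zero : truncRate K ε V m 0 = 0 := by simp [truncRate]

@[simp]
lemma truncRate_succ : truncRate K ε V m (K + 1) = 0 := by simp [truncRate]

end Truncated

/-- `(V, m)` solves the truncated HJB–Kolmogorov system on `[0, T]`. -/
structure IsTruncSolution (K : ℕ) (T r ε : ℝ) (M : ℕ → ℝ) (V m : ℕ → ℝ → ℝ) : Prop where
  zero : ∀ t, V 0 t = 0
  hasDeriv_V : ∀ k ≤ K, ∀ t ∈ Icc 0 T, HasDerivWithinAt (V k)
    (r * V k t - 1 / 4 * truncRate K ε (V · t) (m · t) k ^ 2) (Icc 0 T) t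
  hasDeriv_m : ∀ k ≤ K, ∀ t ∈ Icc 0 T, HasDerivWithinAt (m k)
    (1 / 2 * (truncRate K ε (V · t) (m · t) (k + 1) * clip (m (k + 1) t) -
      truncRate K ε (V · t) (m · t) k * clip (m k t))) (Icc 0 T) t
  terminal : ∀ k ≤ K, V k T = 0
  initial : ∀ k ≤ K, m k 0 = M k

namespace IsTruncSolution

variable {K : ℕ} {T r ε : ℝ} {M : ℕ → ℝ} {V m : ℕ → ℝ → ℝ}

lemma m_nonneg (h : IsTruncSolution K T r ε M V m) (hM : ∀ k ≤ K, 0 ≤ M k) {k : ℕ} (hk : k ≤ K) :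
    ∀ t ∈ Icc 0 T, 0 ≤ m k t := by
  refine nonneg_of_deriv_nonneg_of_neg (h.hasDeriv_m k hk) ?_ fun t _ hlt => ?_
  · rw [h.initial k hk]
    exact hM k hk
  · rw [clip_of_nonpos hlt.le, mul_zero, sub_zero]
    exact mul_nonneg (by norm_num) (mul_nonneg (truncRate_nonneg _) (clip_nonneg _))

lemma sum_m_le_one (h : IsTruncSolution K T r ε M V m) (hK : 1 ≤ K) (hM : ∀ k ≤ K, 0 ≤ M k)
    (hMsum : ∑ k ∈ Finset.Icc 0 K, M k = 1) :
    ∀ t ∈ Icc 0 T, ∑ k ∈ Finset.Icc 1 K, m k t ≤ 1 := by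
  intro t ht
  rw [← sub_nonneg]
  refine nonneg_of_deriv_nonneg_of_neg (f := fun t => 1 - ∑ k ∈ Finset.Icc 1 K, m k t)
    (f' := fun t => 1 / 2 * (truncRate K ε (V · t) (m · t) 1 * clip (m 1 t)))
    (fun t ht => ?_) ?_ (fun t _ _ => ?_) t ht
  · have h1 := (HasDerivWithinAt.fun_sum (u := Finset.Icc 1 K)
      fun k hk => h.hasDeriv_m k (Finset.mem_Icc.1 hk).2 t ht).const_sub 1
    refine h1.congr_deriv ?_
    rw [← Finset.mul_sum, ← Finset.Ico_add_one_right_eq_Icc,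
      Finset.sum_Ico_sub (fun k => truncRate K ε (V · t) (m · t) k * clip (m k t)) (by omega),
      truncRate_succ]
    ring
  · have h1 : ∑ k ∈ Finset.Icc 1 K, m k 0 = ∑ k ∈ Finset.Icc 1 K, M k :=
      Finset.sum_congr rfl fun k hk => h.initial k (Finset.mem_Icc.1 hk).2
    have h2 : ∑ k ∈ Finset.Icc 1 K, M k ≤ ∑ k ∈ Finset.Icc 0 K, M k :=
      Finset.sum_le_sum_of_subset_of_nonneg (Finset.Icc_subset_Icc_left (by omega))
        fun k hk _ => hM k (Finset.mem_Icc.1 hk).2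
    rw [h1]
    linarith
  · exact mul_nonneg (by norm_num) (mul_nonneg (truncRate_nonneg _) (clip_nonneg _))

lemma hasDeriv_diff (h : IsTruncSolution K T r ε M V m) {k : ℕ} (hk : k ≤ K) :
    ∀ t ∈ Icc 0 T, HasDerivWithinAt (fun t => V k t - V (k - 1) t)
      (r * (V k t - V (k - 1) t) - 1 / 4 * (truncRate K ε (V · t) (m · t) k ^ 2 -
        truncRate K ε (V · t) (m · t) (k - 1) ^ 2)) (Icc 0 T) t := by
  intro t ht
  refine ((h.hasDeriv_V k hk t ht).fun_sub (h.hasDeriv_V (k - 1) (by omega) t ht)).congr_deriv ?_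
  ring

lemma diff_nonneg (h : IsTruncSolution K T r ε M V m) (hr : 0 < r) (hε : 0 ≤ ε) {k : ℕ}
    (hk1 : 1 ≤ k) (hk : k ≤ K) : ∀ t ∈ Icc 0 T, 0 ≤ V k t - V (k - 1) t := by
  refine nonneg_of_deriv_nonpos_of_neg (h.hasDeriv_diff hk) ?_ fun t _ hlt => ?_
  · simp [h.terminal k hk, h.terminal (k - 1) (by omega)]
  · have h1 : truncRate K ε (V · t) (m · t) k = truncPrice K ε (V · t) (m · t) := by
      rw [truncRate, if_pos ⟨hk1, hk⟩, clip_of_nonpos hlt.le, sub_zero,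
        max_eq_left (truncPrice_nonneg hε)]
    have h2 := truncRate_le_truncPrice (K := K) (V := (V · t)) (m := (m · t)) hε (k - 1)
    have h3 := pow_le_pow_left₀ (truncRate_nonneg _) h2 2
    rw [h1]
    nlinarith

lemma diff_le_first (h : IsTruncSolution K T r ε M V m) (hr : 0 < r) {k : ℕ}
    (hk1 : 1 ≤ k) (hk : k ≤ K) :
    ∀ t ∈ Icc 0 T, V k t - V (k - 1) t ≤ V 1 t - V 0 t := by
  intro t ht
  rw [← sub_nonneg]
  refine nonneg_of_deriv_nonpos_of_neg
    (fun t ht => (h.hasDeriv_diff (k := 1) (by omega) t ht).fun_sub (h.hasDeriv_diff hk t ht))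
    ?_ (fun t _ hlt => ?_) t ht
  · simp [h.terminal k hk, h.terminal (k - 1) (by omega), h.terminal 1 (by omega),
      h.terminal 0 (by omega)]
  · simp only [Nat.sub_self] at hlt ⊢
    have h1 : truncRate K ε (V · t) (m · t) k ≤ truncRate K ε (V · t) (m · t) 1 := by
      rw [truncRate, truncRate, if_pos ⟨hk1, hk⟩, if_pos ⟨le_rfl, by omega⟩]
      exact max_le_max (sub_le_sub_left (clip_mono (sub_neg.1 hlt).le) _) le_rfl
    have h3 := pow_le_pow_left₀ (truncRate_nonneg _) h1 2
    have h4 := mul_neg_of_pos_of_neg hr hlt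
    rw [truncRate_zero]
    nlinarith [sq_nonneg (truncRate K ε (V · t) (m · t) (k - 1))]

lemma first_le_of_short (h : IsTruncSolution K T r ε M V m) (hr : 0 < r) (hε : 0 ≤ ε)
    (hK : 1 ≤ K) : ∀ t ∈ Icc 0 T, V 1 t - V 0 t ≤ (T - t) / 4 := by
  intro t ht
  rw [← sub_nonneg]
  refine nonneg_of_deriv_nonpos_of_neg (f := fun t => (T - t) / 4 - (V 1 t - V 0 t))
    (fun t ht => ((((hasDerivWithinAt_id t _).const_sub T).div_const 4).fun_sub
      (h.hasDeriv_diff hK t ht))) ?_ (fun t ht _ => ?_) t ht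
  · simp [h.terminal 1 hK, h.terminal 0 (by omega)]
  · have h1 := (truncRate_le_truncPrice (K := K) (V := (V · t)) (m := (m · t)) hε 1).trans
      (truncPrice_le_one hε)
    have h2 := pow_le_one₀ (n := 2) (truncRate_nonneg _) h1
    have h3 := mul_nonneg hr.le (h.diff_nonneg hr hε le_rfl hK t ht)
    simp only [Nat.sub_self, truncRate_zero] at h3 ⊢
    linarith

lemma first_le_of_const (h : IsTruncSolution K T r ε M V m) (hr : 0 < r) (hε : 0 ≤ ε)
    (hK : 1 ≤ K) {c : ℝ} (hc0 : 0 ≤ c) (hc1 : c ≤ 1) (hc : (1 - c) ^ 2 ≤ 4 * r * c) :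
    ∀ t ∈ Icc 0 T, V 1 t - V 0 t ≤ c := by
  intro t ht
  rw [← sub_nonneg]
  refine nonneg_of_deriv_nonpos_of_neg (f := fun t => c - (V 1 t - V 0 t))
    (fun t ht => (h.hasDeriv_diff hK t ht).const_sub c) ?_ (fun t ht hlt => ?_) t ht
  · simpa [h.terminal 1 hK, h.terminal 0 (by omega)] using hc0
  · have h0 : c ≤ V 1 t - V 0 t := (sub_neg.1 hlt).le
    have h1 : truncRate K ε (V · t) (m · t) 1 ≤ 1 - c := by
      rw [truncRate, if_pos ⟨le_rfl, hK⟩]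
      refine max_le ?_ (by linarith)
      have h2 := clip_mono h0
      rw [clip_of_mem hc0 hc1] at h2
      exact sub_le_sub (truncPrice_le_one hε) h2
    have h2 := pow_le_pow_left₀ (truncRate_nonneg _) h1 2
    have h3 := mul_le_mul_of_nonneg_left h0 hr.le
    simp only [Nat.sub_self, truncRate_zero]
    nlinarith

/-- The truncation of a solution is inactive as soon as the first value is not too large. -/
lemma clip_eq_and_truncRate_eq (h : IsTruncSolution K T r ε M V m) (hr : 0 < r) (hε : 0 ≤ ε)
    (hK : 1 ≤ K) (hM : ∀ k ≤ K, 0 ≤ M k) (hMsum : ∑ k ∈ Finset.Icc 0 K, M k = 1)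
    (hfirst : ∀ t ∈ Icc 0 T, V 1 t - V 0 t ≤ 2 / (2 + ε)) {t : ℝ} (ht : t ∈ Icc 0 T) {k : ℕ}
    (hk1 : 1 ≤ k) (hk : k ≤ K) :
    clip (m k t) = m k t ∧ truncRate K ε (V · t) (m · t) k = 2 * marketLam K ε V m k t := by
  have hc1 : 2 / (2 + ε) ≤ 1 := (div_le_one (by positivity)).2 (by linarith)
  have hsum := h.sum_m_le_one hK hM hMsum t ht
  have hm : ∀ j ∈ Finset.Icc 1 K, clip (m j t) = m j t := fun j hj =>
    clip_of_mem (h.m_nonneg hM (Finset.mem_Icc.1 hj).2 t ht)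
      ((Finset.single_le_sum (f := fun j => m j t)
        (fun i hi => h.m_nonneg hM (Finset.mem_Icc.1 hi).2 t ht) hj).trans hsum)
  have hle : ∀ j ∈ Finset.Icc 1 K, V j t - V (j - 1) t ≤ 2 / (2 + ε) := fun j hj =>
    (h.diff_le_first hr (Finset.mem_Icc.1 hj).1 (Finset.mem_Icc.1 hj).2 t ht).trans (hfirst t ht)
  have hD : ∀ j ∈ Finset.Icc 1 K, clip (V j t - V (j - 1) t) = V j t - V (j - 1) t := fun j hj =>
    clip_of_mem (h.diff_nonneg hr hε (Finset.mem_Icc.1 hj).1 (Finset.mem_Icc.1 hj).2 t ht)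
      ((hle j hj).trans hc1)
  have hkm : k ∈ Finset.Icc 1 K := Finset.mem_Icc.2 ⟨hk1, hk⟩
  refine ⟨hm k hkm, ?_⟩
  have hclipsum : ∑ j ∈ Finset.Icc 1 K, clip (m j t) = marketEta K m t :=
    Finset.sum_congr rfl hm
  have hp := le_truncPrice (K := K) (V := (V · t)) (m := (m · t)) hε
    (by rw [hclipsum]; exact hsum)
  have hη : 0 ≤ marketEta K m t := by
    rw [← hclipsum]
    exact Finset.sum_nonneg fun _ _ => clip_nonneg _
  have hprice : truncPrice K ε (V · t) (m · t) = 1 + ε * marketPhi K ε V m t := by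
    have h1 : ∑ j ∈ Finset.Icc 1 K, clip (m j t) * clip (V j t - V (j - 1) t)
        = ∑ j ∈ Finset.Icc 1 K, m j t * (V j t - V (j - 1) t) :=
      Finset.sum_congr rfl fun j hj => by rw [hm j hj, hD j hj]
    rw [truncPrice, hclipsum, h1, marketPhi]
    have : 2 + ε * marketEta K m t ≠ 0 := by positivity
    field_simp
    ring
  rw [truncRate, if_pos ⟨hk1, hk⟩, hD k hkm, max_eq_left, hprice, marketLam]
  · ring
  · exact sub_nonneg.2 ((hle k hkm).trans hp)

lemma isHJBKolSolution (h : IsTruncSolution K T r ε M V m) (hT : 0 < T) (hr : 0 < r) (hε : 0 ≤ ε)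
    (hK : 1 ≤ K) (hM : ∀ k ≤ K, 0 ≤ M k) (hMsum : ∑ k ∈ Finset.Icc 0 K, M k = 1)
    (hfirst : ∀ t ∈ Icc 0 T, V 1 t - V 0 t ≤ 2 / (2 + ε)) :
    IsHJBKolSolution K T r ε M V m := by
  have hu : UniqueDiffOn ℝ (Icc 0 T) := uniqueDiffOn_Icc hT
  have hEq := fun t ht k hk1 hk =>
    h.clip_eq_and_truncRate_eq hr hε hK hM hMsum hfirst (t := t) ht (k := k) hk1 hk
  have hVc : ∀ k ≤ K, ContinuousOn (V k) (Icc 0 T) := fun k hk t ht =>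
    (h.hasDeriv_V k hk t ht).continuousWithinAt
  have hmc : ∀ k ≤ K, ContinuousOn (m k) (Icc 0 T) := fun k hk t ht =>
    (h.hasDeriv_m k hk t ht).continuousWithinAt
  have hηc : ContinuousOn (marketEta K m) (Icc 0 T) :=
    continuousOn_finsetSum _ fun k hk => hmc k (Finset.mem_Icc.1 hk).2
  have hφc : ContinuousOn (marketPhi K ε V m) (Icc 0 T) := by
    refine ContinuousOn.div ?_ (continuousOn_const.add (continuousOn_const.mul hηc)) ?_
    · refine ContinuousOn.sub (continuousOn_finsetSum _ fun k hk => ?_) hηc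
      have hk' := (Finset.mem_Icc.1 hk).2
      exact (hmc k hk').mul ((hVc k hk').sub (hVc (k - 1) (by omega)))
    · intro t ht
      have : 0 ≤ marketEta K m t :=
        Finset.sum_nonneg fun k hk => h.m_nonneg hM (Finset.mem_Icc.1 hk).2 t ht
      positivity
  have hlc : ∀ k ≤ K, ContinuousOn (marketLam K ε V m k) (Icc 0 T) := fun k hk =>
    continuousOn_const.mul ((continuousOn_const.sub ((hVc k hk).sub (hVc (k - 1) (by omega)))).add
      (continuousOn_const.mul hφc))
  have hVd : ∀ k, 1 ≤ k → k ≤ K → ∀ t ∈ Icc 0 T,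
      HasDerivWithinAt (V k) (r * V k t - marketLam K ε V m k t ^ 2) (Icc 0 T) t := by
    intro k hk1 hk t ht
    refine (h.hasDeriv_V k hk t ht).congr_deriv ?_
    rw [(hEq t ht k hk1 hk).2]
    ring
  have hmd0 : ∀ t ∈ Icc 0 T,
      HasDerivWithinAt (m 0) (marketLam K ε V m 1 t * m 1 t) (Icc 0 T) t := by
    intro t ht
    refine (h.hasDeriv_m 0 (by omega) t ht).congr_deriv ?_
    rw [truncRate_zero, zero_add, (hEq t ht 1 le_rfl hK).2, (hEq t ht 1 le_rfl hK).1]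
    ring
  have hmd : ∀ k, 1 ≤ k → k ≤ K - 1 → ∀ t ∈ Icc 0 T, HasDerivWithinAt (m k)
      (marketLam K ε V m (k + 1) t * m (k + 1) t - marketLam K ε V m k t * m k t)
      (Icc 0 T) t := by
    intro k hk1 hk t ht
    refine (h.hasDeriv_m k (by omega) t ht).congr_deriv ?_
    rw [(hEq t ht k hk1 (by omega)).2, (hEq t ht k hk1 (by omega)).1,
      (hEq t ht (k + 1) (by omega) (by omega)).2, (hEq t ht (k + 1) (by omega) (by omega)).1]
    ring
  have hmdK : ∀ t ∈ Icc 0 T,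
      HasDerivWithinAt (m K) (-(marketLam K ε V m K t) * m K t) (Icc 0 T) t := by
    intro t ht
    refine (h.hasDeriv_m K le_rfl t ht).congr_deriv ?_
    rw [truncRate_succ, (hEq t ht K hK le_rfl).2, (hEq t ht K hK le_rfl).1]
    ring
  have hC1 : ∀ {f f' : ℝ → ℝ}, (∀ t ∈ Icc 0 T, HasDerivWithinAt f (f' t) (Icc 0 T) t) →
      ContinuousOn f' (Icc 0 T) → ContDiffOn ℝ 1 f (Icc 0 T) := by
    intro f f' hf hf'
    rw [contDiffOn_one_iff_derivWithin hu]
    exact ⟨fun t ht => (hf t ht).differentiableWithinAt,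
      hf'.congr fun t ht => (hf t ht).derivWithin (hu t ht)⟩
  refine ⟨h.zero, fun k hk1 hk => ?_, fun k hk => ?_, fun k hk1 hk t ht => ?_, fun t ht => ?_,
    fun k hk1 hk t ht => ?_, fun t ht => ?_, fun k _ hk => h.terminal k hk, h.initial⟩
  · exact hC1 (hVd k hk1 hk) ((continuousOn_const.mul (hVc k hk)).sub ((hlc k hk).pow 2))
  · rcases Nat.eq_zero_or_pos k with rfl | hk0
    · exact hC1 hmd0 ((hlc 1 hK).mul (hmc 1 hK))
    · rcases hk.lt_or_eq with hlt | rfl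
      · exact hC1 (hmd k hk0 (by omega)) (((hlc (k + 1) hlt).mul (hmc (k + 1) hlt)).sub
          ((hlc k hk).mul (hmc k hk)))
      · exact hC1 hmdK ((hlc k hk).neg.mul (hmc k hk))
  · rw [(hVd k hk1 hk t ht).derivWithin (hu t ht), marketLam]
    ring
  · exact (hmd0 t ht).derivWithin (hu t ht)
  · exact (hmd k hk1 hk t ht).derivWithin (hu t ht)
  · exact (hmdK t ht).derivWithin (hu t ht)

end IsTruncSolution

/-- Extension by zero of a vector to a sequence indexed by the natural numbers. -/
def extendZero {n : ℕ} (x : Fin n → ℝ) (k : ℕ) : ℝ := if h : k < n then x ⟨k, h⟩ else 0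

/-- Extension by zero of a vector, whose entry of index `0` is replaced by zero. -/
def extendTail {n : ℕ} (x : Fin n → ℝ) (k : ℕ) : ℝ := if k = 0 then 0 else extendZero x k

section Extend

variable {n : ℕ} (x y : Fin n → ℝ)

lemma extendZero_of_lt {k : ℕ} (hk : k < n) : extendZero x k = x ⟨k, hk⟩ := dif_pos hk

lemma abs_extendZero_sub_le (k : ℕ) : |extendZero x k - extendZero y k| ≤ dist x y := by
  by_cases hk : k < n
  · rw [extendZero_of_lt x hk, extendZero_of_lt y hk]
    exact dist_le_pi_dist x y ⟨k, hk⟩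
  · simp [extendZero, hk]

lemma abs_extendTail_sub_le (k : ℕ) : |extendTail x k - extendTail y k| ≤ dist x y := by
  by_cases hk : k = 0
  · simp [extendTail, hk]
  · simpa [extendTail, hk] using abs_extendZero_sub_le x y k

@[simp]
lemma extendTail_zero_right : extendTail x 0 = 0 := by simp [extendTail]

lemma extendTail_of_pos {k : ℕ} (hk0 : k ≠ 0) (hk : k < n) : extendTail x k = x ⟨k, hk⟩ := by
  rw [extendTail, if_neg hk0, extendZero_of_lt x hk]

lemma extendTail_smul (c : ℝ) (k : ℕ) : extendTail (c • x) k = c * extendTail x k := by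
  by_cases hk0 : k = 0
  · simp [hk0]
  · by_cases hk : k < n <;> simp [extendTail, extendZero, hk0, hk]

lemma extendTail_zero_left (k : ℕ) : extendTail (0 : Fin n → ℝ) k = 0 := by
  simp [extendTail, extendZero]

end Extend

lemma isBoundedLipschitz_truncRate {n : ℕ} (K : ℕ) {ε : ℝ} (hε : 0 ≤ ε) (k : ℕ) :
    IsBoundedLipschitz fun z : (Fin n → ℝ) × (Fin n → ℝ) =>
      truncRate K ε (extendTail z.1) (extendZero z.2) k := by
  have hm : ∀ k, IsBoundedLipschitz fun z : (Fin n → ℝ) × (Fin n → ℝ) =>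
      clip (extendZero z.2 k) := fun k =>
    isBoundedLipschitz_clip (C := 1) fun x y => by
      rw [one_mul]
      exact (abs_extendZero_sub_le _ _ k).trans (le_max_right _ _)
  have hV : ∀ k, IsBoundedLipschitz fun z : (Fin n → ℝ) × (Fin n → ℝ) =>
      clip (extendTail z.1 k - extendTail z.1 (k - 1)) := fun k =>
    isBoundedLipschitz_clip (C := 2) fun x y => by
      have h1 := (abs_extendTail_sub_le x.1 y.1 k).trans (le_max_left _ (dist x.2 y.2))
      have h2 := (abs_extendTail_sub_le x.1 y.1 (k - 1)).trans (le_max_left _ (dist x.2 y.2))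
      rw [← Prod.dist_eq] at h1 h2
      rw [sub_sub_sub_comm, two_mul, ← one_mul (dist x y)] at *
      exact (abs_sub _ _).trans (by linarith)
  have hprice : IsBoundedLipschitz fun z : (Fin n → ℝ) × (Fin n → ℝ) =>
      truncPrice K ε (extendTail z.1) (extendZero z.2) :=
    ((IsBoundedLipschitz.const 2).add ((IsBoundedLipschitz.const ε).mul
      (IsBoundedLipschitz.sum fun k => (hm k).mul (hV k)))).mul
      (((IsBoundedLipschitz.const 2).add ((IsBoundedLipschitz.const ε).mul
        (IsBoundedLipschitz.sum fun k => hm k))).inv two_pos fun z =>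
          le_add_of_nonneg_right (mul_nonneg hε (Finset.sum_nonneg fun k _ => clip_nonneg _)))
  by_cases hk : 1 ≤ k ∧ k ≤ K
  · simpa only [truncRate, if_pos hk] using (hprice.sub (hV k)).max_const
  · simpa only [truncRate, if_neg hk] using IsBoundedLipschitz.const 0

lemma IsBoundedLipschitz.exists_pi {X ι : Type*} [PseudoMetricSpace X] [Fintype ι]
    {F : ι → X → ℝ} (h : ∀ i, IsBoundedLipschitz (F i)) :
    ∃ C : ℝ≥0, (∀ x, ‖fun i => F i x‖ ≤ C) ∧ LipschitzWith C fun x i => F i x := by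
  choose c hc hb hl using h
  have hle : ∀ i, c i ≤ ∑ j, c j := fun i =>
    Finset.single_le_sum (fun j _ => hc j) (Finset.mem_univ i)
  have h0 : 0 ≤ ∑ j, c j := Finset.sum_nonneg fun j _ => hc j
  refine ⟨⟨∑ j, c j, h0⟩, fun x => ?_, LipschitzWith.of_dist_le_mul fun x y => ?_⟩
  · exact (pi_norm_le_iff_of_nonneg h0).2 fun i => (hb i x).trans (hle i)
  · refine (dist_pi_le_iff (mul_nonneg h0 dist_nonneg)).2 fun i => (hl i x y).trans ?_
    exact mul_le_mul_of_nonneg_right (hle i) dist_nonneg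

lemma exists_isTruncSolution (K : ℕ) {T r ε : ℝ} (hT : 0 < T) (hr : 0 < r) (hε : 0 ≤ ε)
    (M : ℕ → ℝ) : ∃ V m, IsTruncSolution K T r ε M V m := by
  set E := Fin (K + 1) → ℝ
  set R : E × E → ℕ → ℝ := fun z => truncRate K ε (extendTail z.1) (extendZero z.2)
  have hR : ∀ k, IsBoundedLipschitz fun z => R z k := isBoundedLipschitz_truncRate K hε
  have hm : ∀ k, IsBoundedLipschitz fun z : E × E => clip (extendZero z.2 k) := fun k =>
    isBoundedLipschitz_clip (C := 1) fun x y => by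
      rw [one_mul]
      exact (abs_extendZero_sub_le _ _ k).trans (le_max_right _ _)
  set G₁ : E × E → E := fun z i => -1 / 4 * (R z i * R z i)
  set G₂ : E × E → E := fun z i => 1 / 2 *
    (R z (i + 1) * clip (extendZero z.2 (i + 1)) - R z i * clip (extendZero z.2 i))
  obtain ⟨C₁, hb₁, hl₁⟩ : ∃ C : ℝ≥0, (∀ x, ‖G₁ x‖ ≤ C) ∧ LipschitzWith C G₁ :=
    IsBoundedLipschitz.exists_pi fun i : Fin (K + 1) =>
      (IsBoundedLipschitz.const (-1 / 4)).mul ((hR i).mul (hR i))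
  obtain ⟨C₂, hb₂, hl₂⟩ : ∃ C : ℝ≥0, (∀ x, ‖G₂ x‖ ≤ C) ∧ LipschitzWith C G₂ :=
    IsBoundedLipschitz.exists_pi fun i : Fin (K + 1) => (IsBoundedLipschitz.const (1 / 2)).mul
      (((hR (i + 1)).mul (hm (i + 1))).sub ((hR i).mul (hm i)))
  set S : ℝ → E × E → E × E := fun t z => (Real.exp (r * t) • z.1, z.2)
  have hS : ∀ t ∈ Icc 0 T, LipschitzWith (Real.exp (r * T)).toNNReal (S t) := by
    intro t ht
    refine LipschitzWith.of_dist_le_mul fun x y => ?_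
    rw [Real.coe_toNNReal _ (Real.exp_pos _).le, Prod.dist_eq, Prod.dist_eq]
    have h1 : 1 ≤ Real.exp (r * T) := Real.one_le_exp (by positivity)
    have h2 : Real.exp (r * t) ≤ Real.exp (r * T) :=
      Real.exp_le_exp.2 (mul_le_mul_of_nonneg_left ht.2 hr.le)
    refine max_le ?_ ?_
    · rw [dist_smul₀, Real.norm_of_nonneg (Real.exp_pos _).le]
      gcongr
      exact le_max_left _ _
    · refine (le_max_right _ _).trans (le_mul_of_one_le_left ?_ h1)
      exact le_max_of_le_left dist_nonneg
  set f : ℝ → E × E → E × E := fun t z => (Real.exp (-(r * t)) • G₁ (S t z), G₂ (S t z))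
  have hexp : ∀ t ∈ Icc 0 T, ‖Real.exp (-(r * t))‖ ≤ 1 := by
    intro t ht
    rw [Real.norm_of_nonneg (Real.exp_pos _).le, Real.exp_le_one_iff, neg_nonpos]
    exact mul_nonneg hr.le ht.1
  obtain ⟨α, hα, hαT, hα0⟩ := exists_boundary_value_solution (f := f) (T := T) hT
    (C := max (1 * (C₁ * (Real.exp (r * T)).toNNReal)) (C₂ * (Real.exp (r * T)).toNNReal))
    (L := max C₁ C₂)
    (fun t ht => (((lipschitzWith_smul (Real.exp (-(r * t)))).weaken (hexp t ht)).comp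
      (hl₁.comp (hS t ht))).prodMk (hl₂.comp (hS t ht)))
    (fun z => by
      have hSc : Continuous fun t => S t z := by fun_prop
      have h1 := hl₁.continuous.comp hSc
      have h2 := hl₂.continuous.comp hSc
      have h3 : Continuous fun t => Real.exp (-(r * t)) := by fun_prop
      exact ((h3.smul h1).prodMk h2).continuousOn)
    (fun t ht z => by
      rw [Prod.norm_def, NNReal.coe_max]
      refine max_le_max ?_ (hb₂ _)
      rw [norm_smul]
      exact (mul_le_of_le_one_left (norm_nonneg _) (hexp t ht)).trans (hb₁ _))
    (fun i => M i)
  have hα' : ∀ t ∈ Icc 0 T,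
      HasDerivWithinAt (fun t => (α t).1) (Real.exp (-(r * t)) • G₁ (S t (α t))) (Icc 0 T) t ∧
        HasDerivWithinAt (fun t => (α t).2) (G₂ (S t (α t))) (Icc 0 T) t := fun t ht =>
    ⟨(ContinuousLinearMap.fst ℝ E E).hasFDerivAt.comp_hasDerivWithinAt t (hα t ht),
      (ContinuousLinearMap.snd ℝ E E).hasFDerivAt.comp_hasDerivWithinAt t (hα t ht)⟩
  refine ⟨fun k t => Real.exp (r * t) * extendTail (α t).1 k, fun k t => extendZero (α t).2 k,
    ?_, ?_, ?_, ?_, ?_⟩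
  · simp
  · intro k hk t ht
    have hpad : (fun k => Real.exp (r * t) * extendTail (α t).1 k) =
        extendTail (Real.exp (r * t) • (α t).1) :=
      funext fun k => (extendTail_smul _ _ k).symm
    rw [hpad]
    rcases Nat.eq_zero_or_pos k with rfl | hk0
    · simpa using hasDerivWithinAt_const t (Icc 0 T) (0 : ℝ)
    · have hk' : k < K + 1 := by omega
      simp only [extendTail_of_pos _ hk0.ne' hk']
      have h1 := hasDerivWithinAt_pi.1 (hα' t ht).1 ⟨k, hk'⟩
      have h2 : HasDerivWithinAt (fun t => Real.exp (r * t)) (Real.exp (r * t) * r) (Icc 0 T) t :=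
        ((hasDerivAt_id t).const_mul r).exp.hasDerivWithinAt.congr_deriv (by simp)
      refine (h2.fun_mul h1).congr_deriv ?_
      have h3 : Real.exp (r * t) * Real.exp (-(r * t)) = 1 := by
        rw [← Real.exp_add, add_neg_cancel, Real.exp_zero]
      have h4 : G₁ (S t (α t)) ⟨k, hk'⟩ = -1 / 4 * truncRate K ε
          (extendTail (Real.exp (r * t) • (α t).1)) (extendZero (α t).2) k ^ 2 := by
        rw [pow_two]
      rw [Pi.smul_apply, smul_eq_mul, ← mul_assoc, h3, h4]
      ring
  · intro k hk t ht
    have hpad : (fun k => Real.exp (r * t) * extendTail (α t).1 k) =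
        extendTail (Real.exp (r * t) • (α t).1) :=
      funext fun k => (extendTail_smul _ _ k).symm
    have hk' : k < K + 1 := by omega
    rw [hpad]
    simp only [extendZero_of_lt _ hk']
    refine (hasDerivWithinAt_pi.1 (hα' t ht).2 ⟨k, hk'⟩).congr_deriv ?_
    simp only [G₂, extendZero_of_lt _ hk']
    rfl
  · intro k _
    rw [hαT, extendTail_zero_left, mul_zero]
  · intro k hk
    rw [hα0, extendZero_of_lt _ (by omega)]

lemma interaction_le {K : ℕ} (hK : 1 ≤ K) {T r ε : ℝ} (hT : 0 < T) (hε0 : 0 < ε)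
    (hε : ε < 1 / ((K : ℝ) ^ 2 * T * 2 ^ (K + 8)) * min (1 + (K : ℝ) * T) (Real.sqrt r)) :
    ε * T ≤ 1 + T ∧ ε * T ≤ Real.sqrt r := by
  have hK' : (1 : ℝ) ≤ K := by exact_mod_cast hK
  have hP : (1 : ℝ) ≤ 2 ^ (K + 8) := one_le_pow₀ one_le_two
  have hD : (K : ℝ) * T ≤ (K : ℝ) ^ 2 * T * 2 ^ (K + 8) := by
    have h1 : (K : ℝ) ≤ (K : ℝ) ^ 2 := le_self_pow₀ hK' two_ne_zero
    exact (mul_le_mul_of_nonneg_right h1 hT.le).trans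
      (le_mul_of_one_le_right (by positivity) hP)
  have hKT : 0 < (K : ℝ) * T := by positivity
  have hmin : 0 ≤ min (1 + (K : ℝ) * T) (Real.sqrt r) :=
    le_min (by positivity) (Real.sqrt_nonneg r)
  have h2 : ε ≤ 1 / (K * T) * min (1 + (K : ℝ) * T) (Real.sqrt r) :=
    hε.le.trans (mul_le_mul_of_nonneg_right (one_div_le_one_div_of_le hKT hD) hmin)
  rw [one_div_mul_eq_div, le_div_iff₀ hKT] at h2
  have h3 : ε * T ≤ ε * (K * T) :=
    mul_le_mul_of_nonneg_left (le_mul_of_one_le_left hT.le hK') hε0.le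
  refine ⟨?_, h3.trans (h2.trans (min_le_right _ _))⟩
  have h4 := h2.trans (min_le_left _ _)
  by_contra! h
  nlinarith

end

/-- **Existence.** If `0 < ε < C₁(K,T,r) = (1/(K²·T·2^{K+8}))·min{1 + K·T, √r}`, then the
HJB–Kolmogorov system admits at least one solution on `[0,T]`. -/
theorem exists_solution_of_small_interaction
    (K : ℕ) (hK : 1 ≤ K) (T r ε : ℝ) (hT : 0 < T) (hr : 0 < r)
    (M : ℕ → ℝ) (hM : ∀ k, k ≤ K → 0 ≤ M k)
    (hMsum : ∑ k ∈ Finset.Icc 0 K, M k = 1)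
    (hε0 : 0 < ε)
    (hε1 : ε < 1 / ((K : ℝ) ^ 2 * T * 2 ^ (K + 8)) * min (1 + (K : ℝ) * T) (Real.sqrt r)) :
    ∃ V m : ℕ → ℝ → ℝ, IsHJBKolSolution K T r ε M V m := by
  obtain ⟨V, m, h⟩ := exists_isTruncSolution K hT hr hε0.le M
  refine ⟨V, m, h.isHJBKolSolution hT hr hε0.le hK hM hMsum fun t ht => ?_⟩
  obtain ⟨h1, h2⟩ := interaction_le hK hT hε0 hε1
  rcases le_or_gt T 1 with hT1 | hT1
  · refine (h.first_le_of_short hr hε0.le hK t ht).trans ?_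
    rw [div_le_div_iff₀ four_pos (by positivity)]
    nlinarith [ht.1, ht.2]
  · have h3 : ε ≤ Real.sqrt r := (le_mul_of_one_le_right hε0.le hT1.le).trans h2
    have h4 : ε ^ 2 ≤ r := (Real.le_sqrt hε0.le hr.le).1 h3
    refine h.first_le_of_const hr hε0.le hK (by positivity)
      ((div_le_one (by positivity)).2 (by linarith)) ?_ t ht
    have h5 : 1 - 2 / (2 + ε) = ε / (2 + ε) := by
      field_simp
      ring
    rw [h5, div_pow, mul_div_assoc', div_le_div_iff₀ (by positivity) (by positivity)]
    nlinarith [mul_le_mul_of_nonneg_right h4 (show 0 ≤ 2 + ε by linarith), mul_pos hr hε0,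
      mul_pos (mul_pos hr hε0) hε0]
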